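/- arXiv:2210.01580 — 5 statements merged into one kernel-verified Lean document; each statement's English description precedes it below -/
import Mathlib

section
/- Let n : U × I → ℝ be feasible for the LP relaxation of SB with demands d, i.e. n_{ui} ≥ 0, Σ_{u∈U} n_{ui} = 1 and K_i := Σ_{u∈U} n_{ui} cap_u ≥ d_i for every i ∈ I. Then for every i the set {u ∈ U : cap_u ≥ K_i} is nonempty; choosing for each i a bin combination u_i in this set of minimal cost cin_{u_i} yields a feasible integer solution of SB, and consequently the heuristic value Σ_{i∈I} cin_{u_i} is a valid upper bound: q(d) ≤ Σ_{i∈I} cin_{u_i}. -/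
/-- Feasible solutions of the integer bin-allocation subproblem SB. -/
def SBFeasible {U I : Type*} [Fintype U] [Fintype I]
    (cap : U → ℝ) (d : I → ℝ) (n : U → I → ℝ) : Prop :=
  (∀ u i, n u i = 0 ∨ n u i = 1) ∧
  (∀ i, ∑ u, n u i = 1) ∧
  (∀ i, d i ≤ ∑ u, n u i * cap u)

/-- Objective of SB: total installation cost. -/
def SBCost {U I : Type*} [Fintype U] [Fintype I]
    (cin : U → ℝ) (n : U → I → ℝ) : ℝ :=
  ∑ i, ∑ u, cin u * n u i

/-- Optimal value `q(d)` of the bin-allocation subproblem SB. -/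
noncomputable def SBOpt {U I : Type*} [Fintype U] [Fintype I]
    (cin cap : U → ℝ) (d : I → ℝ) : ℝ :=
  sInf {z | ∃ n : U → I → ℝ, SBFeasible cap d n ∧ SBCost cin n = z}

/-- correctness of the rounding heuristic. If `n` is feasible for the LP
relaxation of SB and `K i = ∑ u, n u i * cap u` is the joint fractional capacity of GAP
`i`, then for each `i` some bin combination has capacity at least `K i`; and choosing for
each GAP a cheapest bin combination `sel i` with capacity at least `K i` yields a feasible
integer solution of SB whose cost `∑ i, cin (sel i)` is an upper bound on `q(d)`. -/
theorem rounding_heuristic_valid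
    {U I : Type*} [Fintype U] [Fintype I] [Nonempty U] [DecidableEq U]
    (cin cap : U → ℝ) (d : I → ℝ)
    (hcin : ∀ u, 0 ≤ cin u) (hcap : ∀ u, 0 ≤ cap u) (hd : ∀ i, 0 ≤ d i)
    (n : U → I → ℝ)
    (hn : ∀ u i, 0 ≤ n u i)
    (hsum : ∀ i, ∑ u, n u i = 1)
    (hcov : ∀ i, d i ≤ ∑ u, n u i * cap u)
    (K : I → ℝ) (hK : ∀ i, K i = ∑ u, n u i * cap u) :
    (∀ i, ∃ u : U, K i ≤ cap u) ∧
    ∀ sel : I → U,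
      (∀ i, K i ≤ cap (sel i)) →
      (∀ i u, K i ≤ cap u → cin (sel i) ≤ cin u) →
      SBFeasible cap d (fun u i => if u = sel i then 1 else 0) ∧
        SBOpt cin cap d ≤ ∑ i, cin (sel i) := by
  refine ⟨fun i => ?_, fun sel h1 h2 => ?_⟩
  · obtain ⟨u, hu⟩ := Finite.exists_max cap
    refine ⟨u, ?_⟩
    rw [hK i]
    calc ∑ v, n v i * cap v ≤ ∑ v, n v i * cap u :=
          Finset.sum_le_sum fun v _ => mul_le_mul_of_nonneg_left (hu v) (hn v i)
      _ = cap u := by rw [← Finset.sum_mul, hsum i, one_mul]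
  · have hf : SBFeasible cap d (fun u i => if u = sel i then 1 else 0) := by
      refine ⟨fun u i => ?_, fun i => ?_, fun i => ?_⟩
      · by_cases h : u = sel i <;> simp [h]
      · simp
      · have h3 := hcov i
        rw [← hK i] at h3
        simpa using h3.trans (h1 i)
    refine ⟨hf, csInf_le ⟨0, ?_⟩ ⟨_, hf, ?_⟩⟩
    · rintro z ⟨m, hm, rfl⟩
      refine Finset.sum_nonneg fun i _ => Finset.sum_nonneg fun u _ => mul_nonneg (hcin u) ?_
      rcases hm.1 u i with h | h <;> simp [h]
    · simp [SBCost]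
end

section
/- (Validity of the integer L-shaped cut.) Let A be a finite set, M a set of binary vectors m : A → {0,1}, q : M → ℝ, and 𝓛 ∈ ℝ with 𝓛 ≤ q(m) for all m ∈ M. Fix m° ∈ M and let S = {a ∈ A : m°(a) = 1}. Then for every m ∈ M: (q(m°) − 𝓛) · ( Σ_{a∈S} m(a) − Σ_{a∉S} m(a) ) − (q(m°) − 𝓛) · (|S| − 1) + 𝓛 ≤ q(m). -/
/-- validity of the integer L-shaped cut of Laporte and Louveaux: with `M` a
set of binary vectors on a finite set `A`, `q : M → ℝ`, a global lower bound `𝓛 ≤ q m`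
for all `m ∈ M`, a fixed `m₀ ∈ M` with active set `S = {a : m₀ a = 1}`, every `m ∈ M`
satisfies the integer L-shaped cut. -/
theorem integer_L_shaped_cut_valid
    {A : Type*} [Fintype A] [DecidableEq A]
    (M : Set (A → ℝ)) (hM : ∀ m ∈ M, ∀ a, m a = 0 ∨ m a = 1)
    (q : (A → ℝ) → ℝ) (𝓛 : ℝ) (h𝓛 : ∀ m ∈ M, 𝓛 ≤ q m)
    (m₀ : A → ℝ) (hm₀ : m₀ ∈ M)
    (S : Finset A) (hS : ∀ a, a ∈ S ↔ m₀ a = 1) :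
    ∀ m ∈ M,
      (q m₀ - 𝓛) * ((∑ a ∈ S, m a) - ∑ a ∈ Sᶜ, m a)
          - (q m₀ - 𝓛) * ((S.card : ℝ) - 1) + 𝓛 ≤ q m := by
  intro m hm
  have h0 := h𝓛 m₀ hm₀
  have h1 := h𝓛 m hm
  have e1 : (S.card : ℝ) - ∑ a ∈ S, m a = ∑ a ∈ S, |m a - m₀ a| := by
    have : (S.card : ℝ) = ∑ a ∈ S, (1 : ℝ) := by simp
    rw [this, ← Finset.sum_sub_distrib]
    refine Finset.sum_congr rfl fun a ha => ?_
    rw [(hS a).1 ha]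
    rcases hM m hm a with h | h <;> simp [h]
  have e2 : ∑ a ∈ Sᶜ, m a = ∑ a ∈ Sᶜ, |m a - m₀ a| := by
    refine Finset.sum_congr rfl fun a ha => ?_
    have hz : m₀ a = 0 :=
      (hM m₀ hm₀ a).resolve_right fun h => (Finset.mem_compl.1 ha) ((hS a).2 h)
    rw [hz]
    rcases hM m hm a with h | h <;> simp [h]
  have e3 := Finset.sum_add_sum_compl S (fun a => |m a - m₀ a|)
  by_cases hEq : m = m₀
  · subst hEq
    simp only [sub_self, abs_zero, Finset.sum_const_zero] at e1 e2
    have : ∑ a ∈ S, m a = S.card := by linarith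
    rw [this, e2]
    linarith
  · obtain ⟨a, ha⟩ := Function.ne_iff.1 hEq
    have h2 : |m a - m₀ a| ≤ ∑ a, |m a - m₀ a| :=
      Finset.single_le_sum (f := fun a => |m a - m₀ a|)
        (fun i _ => abs_nonneg _) (Finset.mem_univ a)
    have h3 : |m a - m₀ a| = 1 := by
      rcases hM m hm a with h | h <;> rcases hM m₀ hm₀ a with h' | h' <;> simp_all
    have h4 : 0 ≤ (q m₀ - 𝓛) * ((S.card : ℝ) - 1 - ((∑ a ∈ S, m a) - ∑ a ∈ Sᶜ, m a)) :=
      mul_nonneg (by linarith) (by linarith)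
    linarith
end

section
/- (Correctness of the divide-and-conquer step of Kung's method in two dimensions.) Let H be a finite set of points (c, k) ∈ ℝ × ℝ (cost, capacity) with pairwise distinct capacities, and let H = T ∪ B be a partition such that every point of T has strictly larger capacity than every point of B. Say p dominates p' if c_p ≤ c_{p'}, k_p ≥ k_{p'} and p ≠ p'; the Pareto front ND(X) of a set X is its set of points not dominated by any point of X. Then ND(H) = ND(T) ∪ { b ∈ ND(B) : no point of ND(T) dominates b }. -/
/-- `p` dominates `q` (cost–capacity points): cost of `p` at most cost of `q`, capacity of
`p` at least capacity of `q`, and `p ≠ q`. -/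
def Dom (p q : ℝ × ℝ) : Prop :=
  p.1 ≤ q.1 ∧ q.2 ≤ p.2 ∧ p ≠ q

/-- The Pareto front (non-dominated points) of a finite set of cost–capacity points. -/
def ND (X : Finset (ℝ × ℝ)) : Set (ℝ × ℝ) :=
  {p | p ∈ X ∧ ¬ ∃ q ∈ X, Dom q p}

/-- correctness of the divide-and-conquer step of Kung's method in 2D: if
`H = T ∪ B` is a partition of a finite set of points with pairwise distinct capacities,
where every point of `T` has strictly larger capacity than every point of `B`, then the
Pareto front of `H` is the Pareto front of `T` together with those points of the Pareto
front of `B` not dominated by any point of the Pareto front of `T`. -/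
theorem kung_divide_and_conquer_step
    (H T B : Finset (ℝ × ℝ))
    (hpart : H = T ∪ B) (hdisj : Disjoint T B)
    (hdistinct : ∀ p ∈ H, ∀ q ∈ H, p ≠ q → p.2 ≠ q.2)
    (hsplit : ∀ t ∈ T, ∀ b ∈ B, b.2 < t.2) :
    ND H = ND T ∪ {b ∈ ND B | ¬ ∃ t ∈ ND T, Dom t b} := by
  have key : ∀ b ∈ B, ∀ t ∈ T, Dom t b → ∃ t ∈ ND T, Dom t b := by
    classical
    intro b hb t ht htb
    obtain ⟨m, hm, hmax⟩ := Finset.exists_max_image (T.filter (fun q => q.1 ≤ b.1))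
      (fun q => q.2 - q.1) ⟨t, by simp only [Finset.mem_filter]; exact ⟨ht, htb.1⟩⟩
    rw [Finset.mem_filter] at hm
    have hlt := hsplit m hm.1 b hb
    refine ⟨m, ⟨hm.1, ?_⟩, hm.2, hlt.le, fun h => by rw [h] at hlt; exact lt_irrefl _ hlt⟩
    rintro ⟨r, hr, h1, h2, h3⟩
    have h := hmax r (by rw [Finset.mem_filter]; exact ⟨hr, h1.trans hm.2⟩)
    exact h3 (Prod.ext (by linarith) (by linarith))
  subst hpart
  ext p
  constructor
  · rintro ⟨hp, hn⟩
    rcases Finset.mem_union.1 hp with h | h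
    · exact Or.inl ⟨h, fun ⟨q, hq, hd⟩ => hn ⟨q, Finset.mem_union_left _ hq, hd⟩⟩
    · exact Or.inr ⟨⟨h, fun ⟨q, hq, hd⟩ => hn ⟨q, Finset.mem_union_right _ hq, hd⟩⟩,
        fun ⟨q, hq, hd⟩ => hn ⟨q, Finset.mem_union_left _ hq.1, hd⟩⟩
  · rintro (⟨hp, hn⟩ | ⟨⟨hp, hn⟩, hn2⟩)
    · refine ⟨Finset.mem_union_left _ hp, ?_⟩
      rintro ⟨q, hq, hd⟩
      rcases Finset.mem_union.1 hq with h | h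
      · exact hn ⟨q, h, hd⟩
      · exact absurd hd.2.1 (not_le.2 (hsplit p hp q h))
    · refine ⟨Finset.mem_union_right _ hp, ?_⟩
      rintro ⟨q, hq, hd⟩
      rcases Finset.mem_union.1 hq with h | h
      · exact hn2 (key p hp q h hd)
      · exact hn ⟨q, h, hd⟩
end

section
/- (The single-commodity flow constraints forbid subtours.) Let I be a finite set, 0 ∉ I a depot, and V = I ∪ {0}. Let x : V × V → {0,1}, v : V × V → ℝ with v ≥ 0, Q > 0, and d : I → ℝ with d_j > 0 for all j. Suppose: (a) v_{ij} ≤ Q·x_{ij} for all arcs (i,j); (b) Σ_{i} x_{iq} = Σ_{j} x_{qj} for every node q ∈ V (degree balance); (c) Σ_{i} x_{ij} ≤ 1 for every j ∈ I; (d) Σ_{i≠j} v_{ij} + d_j ≤ Σ_{i≠j} v_{ji} + Q·(1 − Σ_{i≠j} x_{ij}) for every j ∈ I. Then the arc set {(i,j) : x_{ij} = 1} contains no directed cycle that avoids the depot 0. -/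
/-- the single-commodity flow constraints forbid subtours: on the node set
`V = I ∪ {0}` (modelled as `Option ι`, the depot being `none`), binary arc variables `x`,
nonnegative loads `v`, capacity `Q > 0` and demands `d > 0` satisfying (a) `v ≤ Q·x`,
(b) degree balance, (c) each GAP entered at most once, and (d) the load-flow constraint,
admit no directed cycle (on at least two distinct GAPs) that avoids the depot. -/
theorem flow_constraints_forbid_subtours
    {ι : Type*} [Fintype ι] [DecidableEq ι]
    (x v : Option ι → Option ι → ℝ) (Q : ℝ) (d : ι → ℝ)
    (hx : ∀ i j, x i j = 0 ∨ x i j = 1)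
    (hv : ∀ i j, 0 ≤ v i j)
    (hQ : 0 < Q) (hd : ∀ j, 0 < d j)
    (ha : ∀ i j, v i j ≤ Q * x i j)
    (hb : ∀ q : Option ι, ∑ i, x i q = ∑ j, x q j)
    (hc : ∀ j : ι, ∑ i, x i (some j) ≤ 1)
    (hflow : ∀ j : ι,
      (∑ i ∈ Finset.univ.erase (some j), v i (some j)) + d j ≤
        (∑ i ∈ Finset.univ.erase (some j), v (some j) i) +
          Q * (1 - ∑ i ∈ Finset.univ.erase (some j), x i (some j))) :
    ¬ ∃ (k : ℕ) (c : ℕ → ι), 2 ≤ k ∧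
        (∀ s t, s < k → t < k → c s = c t → s = t) ∧
        (∀ t, t < k → x (some (c t)) (some (c ((t + 1) % k))) = 1) := by
  rintro ⟨k, c, hk, hinj, hcyc⟩
  have hx0 : ∀ i j, 0 ≤ x i j := fun i j => by rcases hx i j with h | h <;> rw [h] <;> norm_num
  have step : ∀ a b e : ι, a ≠ b → e ≠ b → x (some a) (some b) = 1 →
      x (some b) (some e) = 1 → v (some a) (some b) < v (some b) (some e) := by
    intro a b e hab heb h1 h2
    have hmem : some a ∈ Finset.univ.erase (some b) := by simp [hab]
    have hin : x (some a) (some b) ≤ ∑ i ∈ Finset.univ.erase (some b), x i (some b) :=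
      Finset.single_le_sum (f := fun i => x i (some b)) (fun i _ => hx0 i _) hmem
    have hvin : v (some a) (some b) ≤ ∑ i ∈ Finset.univ.erase (some b), v i (some b) :=
      Finset.single_le_sum (f := fun i => v i (some b)) (fun i _ => hv i _) hmem
    have hout : ∑ j, x (some b) j ≤ 1 := by rw [← hb]; exact hc b
    have hz : ∀ i, i ≠ some e → x (some b) i = 0 := by
      intro i hi
      have hp : ∑ j ∈ {i, some e}, x (some b) j ≤ ∑ j, x (some b) j :=
        Finset.sum_le_sum_of_subset_of_nonneg (Finset.subset_univ _) (fun j _ _ => hx0 _ j)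
      rw [Finset.sum_pair hi] at hp
      have := hx0 (some b) i
      linarith
    have hvout : ∑ i ∈ Finset.univ.erase (some b), v (some b) i = v (some b) (some e) := by
      apply Finset.sum_eq_single_of_mem
      · simp [heb]
      · intro i _ hi
        have h := ha (some b) i
        rw [hz i hi, mul_zero] at h
        exact le_antisymm h (hv _ _)
    have hf := hflow b
    rw [hvout] at hf
    have hdb := hd b
    have : Q * (1 - ∑ i ∈ Finset.univ.erase (some b), x i (some b)) ≤ 0 :=
      mul_nonpos_of_nonneg_of_nonpos hQ.le (by linarith)
    linarith
  have hk0 : 0 < k := by omega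
  have hxg : ∀ t, x (some (c (t % k))) (some (c ((t + 1) % k))) = 1 := by
    intro t
    have h := hcyc (t % k) (Nat.mod_lt _ hk0)
    rwa [Nat.mod_add_mod] at h
  have hne : ∀ t, c (t % k) ≠ c ((t + 1) % k) := by
    intro t h
    have h' := hinj _ _ (Nat.mod_lt _ hk0) (Nat.mod_lt _ hk0) h
    have h2 : t + 0 ≡ t + 1 [MOD k] := h'
    have h3 : 0 % k = 1 % k := Nat.ModEq.add_left_cancel' t h2
    rw [Nat.zero_mod, Nat.mod_eq_of_lt (by omega)] at h3
    omega
  have hmono : StrictMono (fun t : ℕ => v (some (c (t % k))) (some (c ((t + 1) % k)))) :=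
    strictMono_nat_of_lt_succ fun t =>
      step _ _ _ (hne t) (hne (t + 1)).symm (hxg t) (hxg (t + 1))
  have := hmono hk0
  simp at this
end

section
/- (Validity of the empty-start valid inequality.) Let I be a finite set, 0 ∉ I a depot, V = I ∪ {0}, x : V × V → {0,1}, v : V × V → ℝ with v ≥ 0, Q > 0, and d : I → ℝ with d_j > 0 for all j. Suppose: (a) v_{ij} ≤ Q·x_{ij}; (b) Σ_i x_{iq} = Σ_j x_{qj} for every q ∈ V; (c) Σ_i x_{ij} ≤ 1 for every j ∈ I; (d) Σ_j x_{0j} ≤ 1; (e) Σ_{i≠j} v_{ij} + d_j ≤ Σ_{i≠j} v_{ji} + Q·(1 − Σ_{i≠j} x_{ij}) for every j ∈ I. Then there exists v' : V × V → ℝ with v' ≥ 0, v'_{0j} = 0 for all j ∈ I, such that (x, v') still satisfies (a) and (e). Hence imposing v_{0jlt} = 0 does not cut off any feasible routing x. -/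
/-- validity of the empty-start valid inequality: given binary arc
variables `x` and nonnegative loads `v` on `V = I ∪ {0}` (modelled as `Option ι`, depot
`none`) satisfying (a) `v ≤ Q·x`, (b) degree balance, (c) each GAP entered at most once,
(d) at most one departure from the depot, and (e) the load-flow constraint, there exist
loads `v'` that vanish on the depot-leaving arcs and still satisfy (a) and (e) together
with `x`. Hence imposing `v_{0j} = 0` does not cut off any feasible routing `x`. -/
theorem empty_start_inequality_valid
    {ι : Type*} [Fintype ι] [DecidableEq ι]
    (x v : Option ι → Option ι → ℝ) (Q : ℝ) (d : ι → ℝ)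
    (hx : ∀ i j, x i j = 0 ∨ x i j = 1)
    (hv : ∀ i j, 0 ≤ v i j)
    (hQ : 0 < Q) (hd : ∀ j, 0 < d j)
    (ha : ∀ i j, v i j ≤ Q * x i j)
    (hb : ∀ q : Option ι, ∑ i, x i q = ∑ j, x q j)
    (hc : ∀ j : ι, ∑ i, x i (some j) ≤ 1)
    (hdep : ∑ j : ι, x none (some j) ≤ 1)
    (hflow : ∀ j : ι,
      (∑ i ∈ Finset.univ.erase (some j), v i (some j)) + d j ≤
        (∑ i ∈ Finset.univ.erase (some j), v (some j) i) +
          Q * (1 - ∑ i ∈ Finset.univ.erase (some j), x i (some j))) :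
    ∃ v' : Option ι → Option ι → ℝ,
      (∀ i j, 0 ≤ v' i j) ∧
      (∀ j : ι, v' none (some j) = 0) ∧
      (∀ i j, v' i j ≤ Q * x i j) ∧
      (∀ j : ι,
        (∑ i ∈ Finset.univ.erase (some j), v' i (some j)) + d j ≤
          (∑ i ∈ Finset.univ.erase (some j), v' (some j) i) +
            Q * (1 - ∑ i ∈ Finset.univ.erase (some j), x i (some j))) := by
  have hle : ∀ i j, (if i = none then 0 else v i j) ≤ v i j := by
    intro i j
    split_ifs
    · exact hv i j
    · exact le_rfl
  refine ⟨fun i j => if i = none then 0 else v i j, ?_, ?_, ?_, ?_⟩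
  · intro i j
    dsimp only
    split_ifs
    · exact le_rfl
    · exact hv i j
  · intro j
    simp
  · intro i j
    exact (hle i j).trans (ha i j)
  · intro j
    have h1 := hflow j
    have h2 : ∑ i ∈ Finset.univ.erase (some j), (if i = none then 0 else v i (some j))
        ≤ ∑ i ∈ Finset.univ.erase (some j), v i (some j) :=
      Finset.sum_le_sum fun i _ => hle i (some j)
    have h3 : ∑ i ∈ Finset.univ.erase (some j), (if some j = none then 0 else v (some j) i)
        = ∑ i ∈ Finset.univ.erase (some j), v (some j) i :=
      Finset.sum_congr rfl fun i _ => if_neg (Option.some_ne_none j)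
    dsimp only
    rw [h3]
    linarith
end
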